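/- arXiv:1608.08598 — 3 statements merged into one kernel-verified Lean document; each statement's English description precedes it below -/
import Mathlib

section
/- Let K be a field, and let L, M, N be cochain complexes of K-vector spaces with cochain maps a : L → M and b : M → N. Let Φ : L ⊕ M → M ⊕ N be the cochain map given componentwise by Φ(l, m) = (a(l) + m, b(m)) (the matrix with entries a, id_M, b and one zero entry). Then the mapping cone of Φ is homotopy equivalent to the mapping cone of the composite b ∘ a : L → N. -/
/-!
Statement 0: If `a : L ⟶ M` and `b : M ⟶ N` are cochain maps of cochain complexes of
`K`-vector spaces, and `Φ : L ⊕ M ⟶ M ⊕ N` is the cochain map given componentwise by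
`Φ(l, m) = (a l + m, b m)`, then `cone(Φ)` is homotopy equivalent to `cone(b ∘ a)`.
-/

open CategoryTheory Limits

/-- The mapping cone of a cochain map `f : A ⟶ B`:
`cone(f)ⁿ = A^{n+1} ⊕ Bⁿ` with differential `∂(a, b) = (-∂a, f a + ∂b)`. -/
noncomputable def MappingCone {K : Type} [Field K] {A B : CochainComplex (ModuleCat K) ℤ}
    (f : A ⟶ B) : CochainComplex (ModuleCat K) ℤ where
  X n := A.X (n + 1) ⊞ B.X n
  d i j :=
    if hij : i + 1 = j then
      biprod.desc
        (biprod.lift (-(A.d (i + 1) (j + 1))) (f.f (i + 1) ≫ eqToHom (congrArg B.X hij)))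
        (biprod.lift 0 (B.d i j))
    else 0
  shape i j hij := dif_neg (by simpa using hij)
  d_comp_d' i j k hij hjk := by
    simp only [ComplexShape.up_Rel] at hij hjk
    subst hij hjk
    simp only [dif_pos rfl, eqToHom_refl]
    apply biprod.hom_ext' <;> apply biprod.hom_ext <;>
      simp [biprod.lift_desc, f.comm]

section Helpers

variable {K : Type} [Field K]

lemma mc_d {A B : CochainComplex (ModuleCat K) ℤ} (f : A ⟶ B) (i : ℤ) :
    (MappingCone f).d i (i + 1) =
      biprod.desc (biprod.lift (-(A.d (i + 1) (i + 1 + 1))) (f.f (i + 1)))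
        (biprod.lift 0 (B.d i (i + 1))) := by
  simp [MappingCone]

/-- The map on cones induced by a commutative square. -/
noncomputable def mcMap {A B A' B' : CochainComplex (ModuleCat K) ℤ} (f : A ⟶ B) (g : A' ⟶ B')
    (u : A ⟶ A') (v : B ⟶ B') (w : f ≫ v = u ≫ g) : MappingCone f ⟶ MappingCone g where
  f n := (biprod.map (u.f (n + 1)) (v.f n) : A.X (n + 1) ⊞ B.X n ⟶ A'.X (n + 1) ⊞ B'.X n)
  comm' i j hij := by
    simp only [ComplexShape.up_Rel] at hij
    subst hij
    have w' := HomologicalComplex.congr_hom w (i + 1)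
    simp only [HomologicalComplex.comp_f] at w'
    rw [mc_d, mc_d]
    have key : biprod.map (u.f (i + 1)) (v.f i) ≫
        biprod.desc (biprod.lift (-(A'.d (i + 1) (i + 1 + 1))) (g.f (i + 1)))
          (biprod.lift 0 (B'.d i (i + 1))) =
        biprod.desc (biprod.lift (-(A.d (i + 1) (i + 1 + 1))) (f.f (i + 1)))
          (biprod.lift 0 (B.d i (i + 1))) ≫ biprod.map (u.f (i + 1 + 1)) (v.f (i + 1)) := by
      apply biprod.hom_ext' <;> apply biprod.hom_ext <;> simp [w']
    exact key

lemma mcMap_comp {A B A' B' A'' B'' : CochainComplex (ModuleCat K) ℤ} (f : A ⟶ B) (g : A' ⟶ B')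
    (h : A'' ⟶ B'') (u : A ⟶ A') (v : B ⟶ B') (w : f ≫ v = u ≫ g)
    (u' : A' ⟶ A'') (v' : B' ⟶ B'') (w' : g ≫ v' = u' ≫ h)
    (u'' : A ⟶ A'') (v'' : B ⟶ B'') (w'' : f ≫ v'' = u'' ≫ h)
    (hu : u ≫ u' = u'') (hv : v ≫ v' = v'') :
    mcMap f g u v w ≫ mcMap g h u' v' w' = mcMap f h u'' v'' w'' := by
  subst hu hv
  ext n : 1
  have key : biprod.map (u.f (n + 1)) (v.f n) ≫ biprod.map (u'.f (n + 1)) (v'.f n) =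
      biprod.map ((u ≫ u').f (n + 1)) ((v ≫ v').f n) := by
    apply biprod.hom_ext' <;> apply biprod.hom_ext <;> simp
  exact key

lemma mcMap_id {A B : CochainComplex (ModuleCat K) ℤ} (f : A ⟶ B)
    (w : f ≫ 𝟙 B = 𝟙 A ≫ f) : mcMap f f (𝟙 A) (𝟙 B) w = 𝟙 _ := by
  ext n : 1
  have key : biprod.map ((𝟙 A : A ⟶ A).f (n + 1)) ((𝟙 B : B ⟶ B).f n) =
      𝟙 (A.X (n + 1) ⊞ B.X n) := by
    apply biprod.hom_ext' <;> apply biprod.hom_ext <;> simp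
  exact key

/-- The homotopy operator on a cone given by a map backwards. -/
noncomputable def mcHom {A B : CochainComplex (ModuleCat K) ℤ} (f : A ⟶ B) (s : B ⟶ A)
    (i j : ℤ) : (MappingCone f).X i ⟶ (MappingCone f).X j :=
  if h : j + 1 = i then
    ((biprod.snd ≫ s.f i ≫ eqToHom (congrArg A.X h.symm) ≫ biprod.inl :
      A.X (i + 1) ⊞ B.X i ⟶ A.X (j + 1) ⊞ B.X j))
  else 0

lemma mcHom_succ {A B : CochainComplex (ModuleCat K) ℤ} (f : A ⟶ B) (s : B ⟶ A) (j : ℤ) :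
    mcHom f s (j + 1) j = ((biprod.snd ≫ s.f (j + 1) ≫ biprod.inl :
      A.X (j + 1 + 1) ⊞ B.X (j + 1) ⟶ A.X (j + 1) ⊞ B.X j)) := by
  simp [mcHom]
  rfl

/-- If `u` and `v` differ from the identity by `f ≫ s` and `s ≫ f`, the induced map on the
cone is homotopic to the identity. -/
noncomputable def mcHomotopy {A B : CochainComplex (ModuleCat K) ℤ} (f : A ⟶ B) (s : B ⟶ A)
    (u : A ⟶ A) (v : B ⟶ B) (w : f ≫ v = u ≫ f) (hu : 𝟙 A = f ≫ s + u) (hv : 𝟙 B = s ≫ f + v) :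
    Homotopy (𝟙 (MappingCone f)) (mcMap f f u v w) where
  hom := mcHom f s
  zero i j hij := dif_neg (by simpa using hij)
  comm n := by
    obtain ⟨n, rfl⟩ : ∃ m, n = m + 1 := ⟨n - 1, by simp⟩
    have hu' := HomologicalComplex.congr_hom hu (n + 1 + 1)
    have hv' := HomologicalComplex.congr_hom hv (n + 1)
    simp only [HomologicalComplex.comp_f, HomologicalComplex.add_f_apply,
      HomologicalComplex.id_f] at hu' hv'
    rw [dNext_eq (mcHom f s) (show (ComplexShape.up ℤ).Rel (n + 1) (n + 1 + 1) by simp),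
      prevD_eq (mcHom f s) (show (ComplexShape.up ℤ).Rel n (n + 1) by simp),
      mc_d, mc_d, mcHom_succ, mcHom_succ]
    have key : 𝟙 (A.X (n + 1 + 1) ⊞ B.X (n + 1)) =
        biprod.desc (biprod.lift (-(A.d (n + 1 + 1) (n + 1 + 1 + 1))) (f.f (n + 1 + 1)))
          (biprod.lift 0 (B.d (n + 1) (n + 1 + 1))) ≫
            (biprod.snd ≫ s.f (n + 1 + 1) ≫ biprod.inl) +
        (biprod.snd ≫ s.f (n + 1) ≫ biprod.inl) ≫
          biprod.desc (biprod.lift (-(A.d (n + 1) (n + 1 + 1))) (f.f (n + 1)))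
            (biprod.lift 0 (B.d n (n + 1))) +
        biprod.map (u.f (n + 1 + 1)) (v.f (n + 1)) := by
      apply biprod.hom_ext' <;> apply biprod.hom_ext <;> simp [← hu', ← hv']
    exact key

end Helpers

/-- The mapping cone of the map `(l, m) ↦ (a l + m, b m) : L ⊕ M ⟶ M ⊕ N` is homotopy
equivalent to the mapping cone of `b ∘ a : L ⟶ N`. -/
theorem cone_of_composite_matrix_homotopy_equiv_cone_of_composite
    (K : Type) [Field K] (L M N : CochainComplex (ModuleCat K) ℤ)
    (a : L ⟶ M) (b : M ⟶ N) :
    Nonempty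
      (HomotopyEquiv
        (MappingCone
          (biprod.lift (biprod.desc a (𝟙 M)) (biprod.snd ≫ b) : L ⊞ M ⟶ M ⊞ N))
        (MappingCone (a ≫ b))) := by
  refine ⟨⟨mcMap _ _ (-biprod.fst) (biprod.snd - biprod.fst ≫ b) ?_,
    mcMap _ _ (biprod.lift (-𝟙 L) a) biprod.inr ?_, ?_, ?_⟩⟩
  · apply biprod.hom_ext' <;> simp
  · apply biprod.hom_ext <;> simp
  · refine ((Homotopy.ofEq ?_).trans (mcHomotopy _ (biprod.fst ≫ biprod.inr)
      ((-biprod.fst) ≫ biprod.lift (-𝟙 L) a)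
      ((biprod.snd - biprod.fst ≫ b) ≫ biprod.inr) ?_ ?_ ?_).symm)
    · exact mcMap_comp _ _ _ _ _ _ _ _ _ _ _ _ rfl rfl
    · apply biprod.hom_ext' <;> apply biprod.hom_ext <;> simp
    · apply biprod.hom_ext' <;> apply biprod.hom_ext <;> simp
    · apply biprod.hom_ext' <;> apply biprod.hom_ext <;> simp
  · refine Homotopy.ofEq ?_
    refine (mcMap_comp _ _ _ _ _ _ _ _ _ (𝟙 L) (𝟙 N) (by simp) ?_ ?_).trans (mcMap_id _ _)
    · simp
    · simp
end

section
/- Let G be a tree on a finite vertex set, equipped with an orientation of its edges such that every internal vertex (vertex of degree at least 2) has in-degree at least 1 and out-degree at least 1. If exactly one leaf of G (vertex of degree at most 1) has in-degree 1 (i.e. its unique incident edge is directed into it), then every internal vertex of G has out-degree exactly 1. -/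
/-- The in-degree of a vertex `v` of a graph `G` with respect to an orientation `D` of its
edges: the number of neighbors `u` of `v` such that the edge `{u, v}` is directed `u → v`. -/
def SimpleGraph.inDeg {V : Type} [Fintype V] (G : SimpleGraph V) [DecidableRel G.Adj]
    (D : V → V → Prop) [DecidableRel D] (v : V) : ℕ :=
  (Finset.univ.filter fun u => G.Adj u v ∧ D u v).card

/-- The out-degree of a vertex `v` of a graph `G` with respect to an orientation `D` of its
edges: the number of neighbors `u` of `v` such that the edge `{v, u}` is directed `v → u`. -/
def SimpleGraph.outDeg {V : Type} [Fintype V] (G : SimpleGraph V) [DecidableRel G.Adj]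
    (D : V → V → Prop) [DecidableRel D] (v : V) : ℕ :=
  (Finset.univ.filter fun u => G.Adj v u ∧ D v u).card

/-- In a finite tree equipped with an orientation of its edges such that every internal
vertex (degree ≥ 2) has both in-degree ≥ 1 and out-degree ≥ 1, if exactly one leaf
(degree ≤ 1) has in-degree 1, then every internal vertex has out-degree exactly 1. -/
theorem outDeg_eq_one_of_unique_sink_leaf
    {V : Type} [Fintype V] [DecidableEq V]
    (G : SimpleGraph V) [DecidableRel G.Adj]
    (hT : G.IsTree)
    (D : V → V → Prop) [DecidableRel D]
    (hor : ∀ u v, G.Adj u v → (D u v ↔ ¬ D v u))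
    (hint : ∀ v, 2 ≤ G.degree v → 1 ≤ G.inDeg D v ∧ 1 ≤ G.outDeg D v)
    (huniq : (Finset.univ.filter fun v => G.degree v ≤ 1 ∧ G.inDeg D v = 1).card = 1) :
    ∀ v, 2 ≤ G.degree v → G.outDeg D v = 1 := by
  classical
  have hdeg : ∀ v, G.inDeg D v + G.outDeg D v = G.degree v := by
    intro v
    unfold SimpleGraph.inDeg SimpleGraph.outDeg
    rw [← G.card_neighborFinset_eq_degree, ← Finset.card_union_of_disjoint]
    · congr 1
      ext u
      simp only [Finset.mem_union, Finset.mem_filter, Finset.mem_univ, true_and,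
        SimpleGraph.mem_neighborFinset]
      constructor
      · rintro (h | h)
        · exact h.1.symm
        · exact h.1
      · intro h
        by_cases hd : D v u
        · exact Or.inr ⟨h, hd⟩
        · exact Or.inl ⟨h.symm, (hor u v h.symm).2 hd⟩
    · rw [Finset.disjoint_left]
      intro u h1 h2
      simp only [Finset.mem_filter, Finset.mem_univ, true_and] at h1 h2
      exact (hor u v h1.1).1 h1.2 h2.2
  have hsum : ∑ v, G.inDeg D v = ∑ v, G.outDeg D v := by
    simp only [SimpleGraph.inDeg, SimpleGraph.outDeg, Finset.card_filter]
    exact Finset.sum_comm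
  have h2 := G.sum_degrees_eq_twice_card_edges
  have hE := hT.card_edgeFinset
  simp only [← hdeg, Finset.sum_add_distrib] at h2
  obtain ⟨s, hs⟩ := Finset.card_eq_one.1 huniq
  have hmem : ∀ v, (G.degree v ≤ 1 ∧ G.inDeg D v = 1) ↔ v = s := by
    intro v
    have : v ∈ (Finset.univ.filter fun v => G.degree v ≤ 1 ∧ G.inDeg D v = 1) ↔ v ∈ ({s} : Finset V) := by
      rw [hs]
    simpa using this
  have hge : ∀ v ∈ Finset.univ.erase s, 1 ≤ G.outDeg D v := by
    intro v hv
    have hvs : v ≠ s := Finset.ne_of_mem_erase hv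
    by_cases hd : 2 ≤ G.degree v
    · exact (hint v hd).2
    · have : Nontrivial V := ⟨v, s, hvs⟩
      have hpos := hT.connected.preconnected.degree_pos_of_nontrivial v
      have hn := mt (hmem v).1 hvs
      have := hdeg v
      have : G.inDeg D v ≠ 1 := fun h => hn ⟨by omega, h⟩
      omega
  have hsplit := Finset.sum_erase_add Finset.univ (fun v => G.outDeg D v) (Finset.mem_univ s)
  have hcard : (Finset.univ.erase s).card + 1 = Fintype.card V :=
    Finset.card_erase_add_one (Finset.mem_univ s)
  have hle := Finset.sum_le_sum hge
  have hone : ∑ v ∈ Finset.univ.erase s, 1 = (Finset.univ.erase s).card := by simp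
  have heq := (Finset.sum_eq_sum_iff_of_le hge).1 (by omega)
  intro v hv
  have hvs : v ≠ s := fun h => by
    have := ((hmem v).2 h).1
    omega
  exact (heq v (Finset.mem_erase.2 ⟨hvs, Finset.mem_univ v⟩)).symm
end

section
/- Let G be a tree on a finite vertex set, equipped with an orientation of its edges such that every internal vertex (vertex of degree at least 2) has in-degree at least 1 and out-degree at least 1. If at least two leaves of G (vertices of degree at most 1) have in-degree 1 (i.e. their unique incident edges are directed into them), then some internal vertex of G has out-degree at least 2. -/
/-- In a finite tree equipped with an orientation of its edges such that every internal
vertex (degree ≥ 2) has both in-degree ≥ 1 and out-degree ≥ 1, if at least two distinct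
leaves (degree ≤ 1) have in-degree 1, then some internal vertex has out-degree ≥ 2. -/
theorem exists_internal_vertex_with_two_outputs
    {V : Type} [Fintype V] [DecidableEq V]
    (G : SimpleGraph V) [DecidableRel G.Adj]
    (hT : G.IsTree)
    (D : V → V → Prop) [DecidableRel D]
    (hor : ∀ u v, G.Adj u v → (D u v ↔ ¬ D v u))
    (hint : ∀ v, 2 ≤ G.degree v → 1 ≤ G.inDeg D v ∧ 1 ≤ G.outDeg D v)
    (hleaves : ∃ l₁ l₂ : V, l₁ ≠ l₂ ∧
      (G.degree l₁ ≤ 1 ∧ G.inDeg D l₁ = 1) ∧ (G.degree l₂ ≤ 1 ∧ G.inDeg D l₂ = 1)) :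
    ∃ v, 2 ≤ G.degree v ∧ 2 ≤ G.outDeg D v := by
  by_contra! hcon
  have hdeg : ∀ v, G.inDeg D v + G.outDeg D v = G.degree v := by
    intro v
    unfold SimpleGraph.inDeg SimpleGraph.outDeg
    rw [← SimpleGraph.card_neighborFinset_eq_degree, ← Finset.card_union_of_disjoint]
    · congr 1
      ext u
      have h1 := hor u v
      have h2 := G.adj_comm u v
      simp only [Finset.mem_union, Finset.mem_filter, Finset.mem_univ, true_and,
        SimpleGraph.mem_neighborFinset]
      tauto
    · rw [Finset.disjoint_left]
      intro u
      have h1 := hor u v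
      simp only [Finset.mem_filter, Finset.mem_univ, true_and]
      tauto
  have hsum : ∑ v, G.inDeg D v = ∑ v, G.outDeg D v := by
    unfold SimpleGraph.inDeg SimpleGraph.outDeg
    simp only [Finset.card_filter]
    rw [Finset.sum_comm]
  have hE := G.sum_degrees_eq_twice_card_edges
  have hn := hT.card_edgeFinset
  simp only [← hdeg, Finset.sum_add_distrib] at hE
  obtain ⟨l₁, l₂, hne, ⟨a1, a2⟩, b1, b2⟩ := hleaves
  have hle : ∀ v, G.outDeg D v + (if v = l₁ then 1 else 0) + (if v = l₂ then 1 else 0) ≤ 1 := by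
    intro v
    have h1 := hdeg v
    have h2 := hcon v
    split_ifs with h3 h4 h4
    · exact absurd (h3.symm.trans h4) hne
    · subst h3; omega
    · subst h4; omega
    · by_cases h : 2 ≤ G.degree v
      · have := h2 h; omega
      · omega
  have hS := Finset.sum_le_sum (fun v (_ : v ∈ Finset.univ) => hle v)
  simp only [Finset.sum_add_distrib, Finset.sum_ite_eq', Finset.mem_univ, if_true,
    Finset.sum_const, Finset.card_univ, smul_eq_mul, mul_one] at hS
  omega
end
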